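/- For every even integer p ≥ 4 there exists a constant ĉ₀ = ĉ₀(p) > 0 such that the following holds for every n. Let T̂ = T + E ∈ ⊗^p ℝ^n, where T = Σ_{i=1}^n λ_i v_i^⊗p with λ_i ≠ 0 for all i, {v₁,…,v_n} an orthonormal basis of ℝ^n, and E a symmetric tensor with operator norm ε := ‖E‖. Assume ε ≤ ĉ₀ (min_i |λ_i|) / n^{1/(p−1)}. Let {(λ̂_i, v̂_i)}_{i=1}^n be the output of SROA applied to T̂, where each step chooses v̂_i ∈ argmax_{‖v‖₂=1} |T̂_{i−1} v^⊗p|, λ̂_i := T̂_{i−1} v̂_i^⊗p, T̂_i := T̂_{i−1} − λ̂_i v̂_i^⊗p. Then there exists a permutation π of {1,…,n} such that for all j: |λ_{π(j)} − λ̂_j| ≤ 2ε and min{‖v_{π(j)} − v̂_j‖₂, ‖v_{π(j)} + v̂_j‖₂} ≤ 20ε/|λ_{π(j)}|. -/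

import Mathlib

open scoped RealInnerProductSpace BigOperators

/-- The symmetric rank-one tensor `v^⊗p`, with entries `v_{i₁} ⋯ v_{i_p}`. -/
noncomputable def tpow {n : ℕ} (p : ℕ) (v : EuclideanSpace ℝ (Fin n)) : (Fin p → Fin n) → ℝ :=
  fun idx => ∏ k, v (idx k)

/-- `T x^⊗p = ∑_{i₁,…,i_p} T_{i₁,…,i_p} x_{i₁} ⋯ x_{i_p}`. -/
noncomputable def tapply {p n : ℕ} (T : (Fin p → Fin n) → ℝ) (x : EuclideanSpace ℝ (Fin n)) : ℝ :=
  ∑ idx : Fin p → Fin n, T idx * ∏ k, x (idx k)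

/-- A tensor is symmetric if its entries are invariant under all permutations of the indices. -/
def tsymm {p n : ℕ} (T : (Fin p → Fin n) → ℝ) : Prop :=
  ∀ (σ : Equiv.Perm (Fin p)) (idx : Fin p → Fin n), T (idx ∘ σ) = T idx

/-- Operator norm of a (symmetric) tensor: `sup_{‖x‖₂=1} |T x^⊗p|`. -/
noncomputable def tnorm {p n : ℕ} (T : (Fin p → Fin n) → ℝ) : ℝ :=
  sSup {r | ∃ x : EuclideanSpace ℝ (Fin n), ‖x‖ = 1 ∧ |tapply T x| = r}

section

variable {p n : ℕ}

theorem tapply_tpow (v y : EuclideanSpace ℝ (Fin n)) :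
    tapply (tpow p v) y = ⟪v, y⟫ ^ p := by
  simp only [tapply, tpow, ← Finset.prod_mul_distrib]
  rw [PiLp.inner_apply, Fintype.sum_pow]
  simp [mul_comm]

theorem tapply_add (A B : (Fin p → Fin n) → ℝ) (y : EuclideanSpace ℝ (Fin n)) :
    tapply (A + B) y = tapply A y + tapply B y := by
  simp [tapply, add_mul, Finset.sum_add_distrib]

theorem tapply_sub (A B : (Fin p → Fin n) → ℝ) (y : EuclideanSpace ℝ (Fin n)) :
    tapply (A - B) y = tapply A y - tapply B y := by
  simp [tapply, sub_mul, Finset.sum_sub_distrib]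

theorem tapply_smul (c : ℝ) (A : (Fin p → Fin n) → ℝ) (y : EuclideanSpace ℝ (Fin n)) :
    tapply (c • A) y = c * tapply A y := by
  simp [tapply, mul_assoc, Finset.mul_sum]

theorem tapply_sum {ι : Type*} (s : Finset ι) (A : ι → (Fin p → Fin n) → ℝ)
    (y : EuclideanSpace ℝ (Fin n)) :
    tapply (∑ i ∈ s, A i) y = ∑ i ∈ s, tapply (A i) y := by
  simp only [tapply, Finset.sum_apply, Finset.sum_mul]
  exact Finset.sum_comm

theorem abs_tapply_le_tnorm (T : (Fin p → Fin n) → ℝ) {x : EuclideanSpace ℝ (Fin n)}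
    (hx : ‖x‖ = 1) : |tapply T x| ≤ tnorm T := by
  refine le_csSup ⟨∑ idx, |T idx|, ?_⟩ ⟨x, hx, rfl⟩
  rintro r ⟨y, hy, rfl⟩
  refine (Finset.abs_sum_le_sum_abs _ _).trans (Finset.sum_le_sum fun idx _ => ?_)
  rw [abs_mul, Finset.abs_prod]
  refine mul_le_of_le_one_right (abs_nonneg _) (Finset.prod_le_one (fun _ _ => abs_nonneg _) ?_)
  intro k _
  rw [← hy]
  exact PiLp.norm_apply_le y (idx k)

/-- The complexified form `T (((w + 1) / 2) x + ((w - 1) / (2 i)) u)^⊗p`; on the unit circle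
`w = exp (2 i t)` it equals `exp (i p t) T (cos t x + sin t u)^⊗p`. -/
noncomputable def circleExtension (T : (Fin p → Fin n) → ℝ) (x u : EuclideanSpace ℝ (Fin n))
    (w : ℂ) : ℂ :=
  ∑ idx : Fin p → Fin n, (T idx : ℂ) *
    ∏ k, ((w + 1) / 2 * (x (idx k) : ℂ) + (w - 1) / (2 * Complex.I) * (u (idx k) : ℂ))

theorem differentiable_circleExtension (T : (Fin p → Fin n) → ℝ)
    (x u : EuclideanSpace ℝ (Fin n)) : Differentiable ℂ (circleExtension T x u) := by
  unfold circleExtension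
  fun_prop

theorem circleExtension_exp (T : (Fin p → Fin n) → ℝ) (x u : EuclideanSpace ℝ (Fin n)) (t : ℝ) :
    circleExtension T x u (Complex.exp (2 * t * Complex.I)) =
      Complex.exp (t * Complex.I) ^ p *
        (tapply T (Real.cos t • x + Real.sin t • u) : ℝ) := by
  have h1 : (Complex.exp (2 * t * Complex.I) + 1) / 2 =
      Complex.exp (t * Complex.I) * Complex.cos t := by
    have : Complex.exp (2 * t * Complex.I) = Complex.exp (t * Complex.I) ^ 2 := by
      rw [← Complex.exp_nat_mul]; congr 1; push_cast; ring
    have h2 : Complex.exp (t * Complex.I) * Complex.exp (-t * Complex.I) = 1 := by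
      rw [← Complex.exp_add]; simp
    rw [this, Complex.cos]
    linear_combination (-1 / 2) * h2
  have h3 : (Complex.exp (2 * t * Complex.I) - 1) / (2 * Complex.I) =
      Complex.exp (t * Complex.I) * Complex.sin t := by
    have : Complex.exp (2 * t * Complex.I) = Complex.exp (t * Complex.I) ^ 2 := by
      rw [← Complex.exp_nat_mul]; congr 1; push_cast; ring
    have h2 : Complex.exp (t * Complex.I) * Complex.exp (-t * Complex.I) = 1 := by
      rw [← Complex.exp_add]; simp
    rw [this, Complex.sin, div_eq_iff (by simp)]
    linear_combination (-Complex.I ^ 2) * h2 + (Complex.exp (t * Complex.I) ^ 2 - 1) * Complex.I_sq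
  rw [circleExtension, h1, h3, tapply]
  push_cast
  rw [Finset.mul_sum]
  refine Finset.sum_congr rfl fun idx _ => ?_
  simp only [mul_assoc, ← mul_add]
  rw [Finset.prod_mul_distrib]
  simp
  ring

theorem norm_circleExtension_le_of_norm_le_one {T : (Fin p → Fin n) → ℝ}
    {x u : EuclideanSpace ℝ (Fin n)} {ε : ℝ}
    (h : ∀ t : ℝ, |tapply T (Real.cos t • x + Real.sin t • u)| ≤ ε) {w : ℂ} (hw : ‖w‖ ≤ 1) :
    ‖circleExtension T x u w‖ ≤ ε := by
  refine Complex.norm_le_of_forall_mem_frontier_norm_le (U := Metric.ball (0 : ℂ) 1)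
    Metric.isBounded_ball (differentiable_circleExtension T x u).diffContOnCl ?_ ?_
  · intro z hz
    rw [frontier_ball (0 : ℂ) one_ne_zero, mem_sphere_zero_iff_norm] at hz
    have hz' : z = Complex.exp (2 * ((z.arg / 2 : ℝ) : ℂ) * Complex.I) := by
      conv_lhs => rw [← Complex.norm_mul_exp_arg_mul_I z, hz]
      push_cast
      rw [one_mul]
      congr 1
      ring
    rw [hz', circleExtension_exp, norm_mul, norm_pow, Complex.norm_exp_ofReal_mul_I, one_pow,
      one_mul, Complex.norm_real]
    exact h _
  · rw [closure_ball (0 : ℂ) one_ne_zero]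
    simpa using hw

theorem circleExtension_eq_pow_mul (T : (Fin p → Fin n) → ℝ) (x u : EuclideanSpace ℝ (Fin n))
    {w : ℂ} (hw : w ≠ 0) :
    circleExtension T x u w = w ^ p * circleExtension T x (-u) w⁻¹ := by
  rw [circleExtension, circleExtension, Finset.mul_sum]
  refine Finset.sum_congr rfl fun idx _ => ?_
  rw [mul_left_comm]
  congr 1
  rw [← Fin.prod_const, ← Finset.prod_mul_distrib]
  refine Finset.prod_congr rfl fun k _ => ?_
  have := Complex.I_ne_zero
  simp only [PiLp.neg_apply, Complex.ofReal_neg]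
  field_simp
  ring

theorem norm_circleExtension_le {T : (Fin p → Fin n) → ℝ} {x u : EuclideanSpace ℝ (Fin n)}
    {ε : ℝ} (h : ∀ t : ℝ, |tapply T (Real.cos t • x + Real.sin t • u)| ≤ ε) {w : ℂ} {r : ℝ}
    (hr : 1 ≤ r) (hw : ‖w‖ ≤ r) : ‖circleExtension T x u w‖ ≤ r ^ p * ε := by
  have hε : 0 ≤ ε := (abs_nonneg _).trans (h 0)
  rcases le_total ‖w‖ 1 with h1 | h1
  · exact (norm_circleExtension_le_of_norm_le_one h h1).trans
      (le_mul_of_one_le_left hε (one_le_pow₀ hr))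
  · have hw0 : w ≠ 0 := by
      rintro rfl
      norm_num at h1
    rw [circleExtension_eq_pow_mul T x u hw0, norm_mul, norm_pow]
    refine mul_le_mul (pow_le_pow_left₀ (norm_nonneg _) hw p) ?_ (norm_nonneg _) (by positivity)
    refine norm_circleExtension_le_of_norm_le_one (fun t => ?_) ?_
    · simpa using h (-t)
    · rw [norm_inv]
      exact inv_le_one_of_one_le₀ h1

/-- A Bernstein-type inequality for homogeneous forms restricted to a great circle. -/
theorem exists_hasDerivAt_tapply_circle (hp : 0 < p) {T : (Fin p → Fin n) → ℝ}
    {x u : EuclideanSpace ℝ (Fin n)} {ε : ℝ}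
    (h : ∀ t : ℝ, |tapply T (Real.cos t • x + Real.sin t • u)| ≤ ε) :
    ∃ D, HasDerivAt (fun t : ℝ => tapply T (Real.cos t • x + Real.sin t • u)) D 0 ∧
      |D| ≤ 7 * p * ε := by
  have hp' : (0 : ℝ) < p := by exact_mod_cast hp
  have hε : 0 ≤ ε := (abs_nonneg _).trans (h 0)
  have hdiff : DifferentiableAt ℝ
      (fun t : ℝ => tapply T (Real.cos t • x + Real.sin t • u)) 0 := by
    simp only [tapply, PiLp.add_apply, PiLp.smul_apply]
    fun_prop
  refine ⟨_, hdiff.hasDerivAt, ?_⟩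
  set D := deriv (fun t : ℝ => tapply T (Real.cos t • x + Real.sin t • u)) 0
  have hG : ‖deriv (circleExtension T x u) 1‖ ≤ Real.exp 1 * ε / (1 / p) := by
    refine Complex.norm_deriv_le_of_forall_mem_sphere_norm_le (by positivity)
      (differentiable_circleExtension T x u).diffContOnCl fun z hz => ?_
    have hz' : ‖z‖ ≤ 1 + 1 / p := by
      rw [mem_sphere_iff_norm] at hz
      calc ‖z‖ = ‖1 + (z - 1)‖ := by congr 1; ring
        _ ≤ 1 + 1 / p := by simpa [hz] using norm_add_le (1 : ℂ) (z - 1)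
    refine (norm_circleExtension_le h (by simp) hz').trans ?_
    gcongr
    calc (1 + 1 / (p : ℝ)) ^ p ≤ Real.exp (1 / p) ^ p := by
          gcongr
          linarith [Real.add_one_le_exp (1 / (p : ℝ))]
      _ = Real.exp 1 := by rw [← Real.exp_nat_mul]; congr 1; field_simp
  have hG1 : ‖circleExtension T x u 1‖ ≤ ε :=
    norm_circleExtension_le_of_norm_le_one h (by simp)
  have e1 : HasDerivAt (fun t : ℝ => Complex.exp (t * Complex.I)) Complex.I 0 := by
    have := ((hasDerivAt_id (0 : ℝ)).ofReal_comp.mul_const Complex.I).cexp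
    simpa using this
  have e2 : HasDerivAt (fun t : ℝ => Complex.exp (2 * t * Complex.I)) (2 * Complex.I) 0 := by
    have := (((hasDerivAt_id (0 : ℝ)).ofReal_comp.const_mul 2).mul_const Complex.I).cexp
    simpa using this
  have hl : HasDerivAt (fun t : ℝ => circleExtension T x u (Complex.exp (2 * t * Complex.I)))
      (deriv (circleExtension T x u) 1 * (2 * Complex.I)) 0 := by
    have h0 : HasDerivAt (circleExtension T x u) (deriv (circleExtension T x u) 1)
        (Complex.exp (2 * ((0 : ℝ) : ℂ) * Complex.I)) := by
      simpa using (differentiable_circleExtension T x u 1).hasDerivAt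
    exact h0.comp (0 : ℝ) e2
  have hr : HasDerivAt (fun t : ℝ => Complex.exp (t * Complex.I) ^ p *
      ((tapply T (Real.cos t • x + Real.sin t • u) : ℝ) : ℂ))
      (p * Complex.I * circleExtension T x u 1 + D) 0 := by
    have h1 := circleExtension_exp T x u 0
    have := (e1.fun_pow p).mul hdiff.hasDerivAt.ofReal_comp
    refine this.congr_deriv ?_
    simp only [Complex.ofReal_zero, mul_zero, zero_mul, Complex.exp_zero, one_pow, one_mul] at h1
    simp [h1, D]
  have hD : (D : ℂ) = deriv (circleExtension T x u) 1 * (2 * Complex.I) -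
      p * Complex.I * circleExtension T x u 1 := by
    have := hl.unique (hr.congr_of_eventuallyEq
      (Filter.Eventually.of_forall fun t => circleExtension_exp T x u t))
    rw [this]
    ring
  have he : Real.exp 1 ≤ 3 := Real.exp_one_lt_three.le
  calc |D| = ‖(D : ℂ)‖ := by rw [Complex.norm_real]; rfl
    _ ≤ ‖deriv (circleExtension T x u) 1‖ * 2 + p * ‖circleExtension T x u 1‖ := by
        rw [hD]
        refine (norm_sub_le _ _).trans ?_
        simp
    _ ≤ (Real.exp 1 * ε / (1 / p)) * 2 + p * ε := by gcongr
    _ ≤ (3 * ε / (1 / p)) * 2 + p * ε := by gcongr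
    _ = 7 * p * ε := by field_simp; ring

end

theorem hasDerivAt_inner_circle_pow {F : Type*} [NormedAddCommGroup F] [InnerProductSpace ℝ F]
    (p : ℕ) (a x u : F) :
    HasDerivAt (fun t : ℝ => ⟪a, Real.cos t • x + Real.sin t • u⟫ ^ p)
      (p * ⟪a, x⟫ ^ (p - 1) * ⟪a, u⟫) 0 := by
  have h : HasDerivAt (fun t : ℝ => Real.cos t * ⟪a, x⟫ + Real.sin t * ⟪a, u⟫) ⟪a, u⟫ 0 := by
    have := ((Real.hasDerivAt_cos 0).mul_const ⟪a, x⟫).add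
      ((Real.hasDerivAt_sin 0).mul_const ⟪a, u⟫)
    exact this.congr_deriv (by simp)
  simpa [inner_add_right, inner_smul_right] using h.fun_pow p

theorem norm_cos_smul_add_sin_smul {F : Type*} [NormedAddCommGroup F] [InnerProductSpace ℝ F]
    {x u : F} (hx : ‖x‖ = 1) (hu : ‖u‖ = 1) (hxu : ⟪x, u⟫ = 0) (t : ℝ) :
    ‖Real.cos t • x + Real.sin t • u‖ = 1 := by
  have h : ‖Real.cos t • x + Real.sin t • u‖ ^ 2 = 1 := by
    rw [norm_add_sq_real, norm_smul, norm_smul, inner_smul_left, inner_smul_right, hxu, hx, hu]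
    simp
  exact (pow_eq_one_iff_of_nonneg (norm_nonneg _) two_ne_zero).1 h

/-- One deflation error, split according to its three sources. -/
theorem abs_deflation_term_le {p : ℕ} {ε d l lh x u a b : ℝ}
    (hl : |l - lh| ≤ 2 * ε) (ha : |l| * |a - x| ≤ 20 * ε) (had : |a - x| ≤ d)
    (hb : |l| * |b - u| ≤ 20 * ε) (hb1 : |b| ≤ 1) :
    |l * x ^ (p - 1) * u - lh * a ^ (p - 1) * b| ≤
      ε * (22 * (|x| + d) ^ (p - 1) + 20 * p * ((|x| + d) ^ (p - 2) * |u|)) := by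
  have hd : 0 ≤ d := (abs_nonneg _).trans had
  have hε : 0 ≤ ε := by linarith [(abs_nonneg _).trans hl]
  have hxm : |x| ≤ |x| + d := by linarith
  have ham : |a| ≤ |x| + d := by
    calc |a| = |x + (a - x)| := by ring_nf
      _ ≤ |x| + d := (abs_add_le _ _).trans (by linarith)
  have hm : 0 ≤ |x| + d := by positivity
  have h1 : |(l - lh) * a ^ (p - 1) * b| ≤ 2 * ε * (|x| + d) ^ (p - 1) := by
    rw [abs_mul, abs_mul, abs_pow]
    calc |l - lh| * |a| ^ (p - 1) * |b| ≤ (2 * ε) * (|x| + d) ^ (p - 1) * 1 := by gcongr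
      _ = _ := by ring
  have h2 : |l * (a ^ (p - 1) * (u - b))| ≤ 20 * ε * (|x| + d) ^ (p - 1) := by
    rw [abs_mul, abs_mul, abs_pow, abs_sub_comm u b]
    calc |l| * (|a| ^ (p - 1) * |b - u|) = (|l| * |b - u|) * |a| ^ (p - 1) := by ring
      _ ≤ 20 * ε * (|x| + d) ^ (p - 1) := by gcongr
  have h3 : |l * (x ^ (p - 1) - a ^ (p - 1)) * u| ≤
      20 * ε * p * ((|x| + d) ^ (p - 2) * |u|) := by
    have hmv : |x ^ (p - 1) - a ^ (p - 1)| ≤ |a - x| * p * (|x| + d) ^ (p - 2) := by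
      refine (abs_pow_sub_pow_le x a (p - 1)).trans ?_
      rw [abs_sub_comm x a, Nat.sub_sub]
      have : ((p - 1 : ℕ) : ℝ) ≤ p := by exact_mod_cast Nat.sub_le p 1
      gcongr
      exact max_le hxm ham
    rw [abs_mul, abs_mul]
    calc |l| * |x ^ (p - 1) - a ^ (p - 1)| * |u|
        ≤ |l| * (|a - x| * p * (|x| + d) ^ (p - 2)) * |u| := by gcongr
      _ = (|l| * |a - x|) * (p * ((|x| + d) ^ (p - 2) * |u|)) := by ring
      _ ≤ (20 * ε) * (p * ((|x| + d) ^ (p - 2) * |u|)) := by gcongr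
      _ = _ := by ring
  calc |l * x ^ (p - 1) * u - lh * a ^ (p - 1) * b|
      = |(l - lh) * a ^ (p - 1) * b + l * (a ^ (p - 1) * (u - b)) +
          l * (x ^ (p - 1) - a ^ (p - 1)) * u| := by ring_nf
    _ ≤ _ := (abs_add_three _ _ _).trans (by linarith)

/-- The accumulated deflation errors are controlled by how much `x` overlaps with the
components already removed. -/
theorem abs_sum_deflation_le {ι : Type*} {p : ℕ} (hp : 4 ≤ p) (s : Finset ι) {ε d B : ℝ}
    {l lh x u a b : ι → ℝ} (hε : 0 ≤ ε) (hd0 : 0 ≤ d) (hd1 : d ≤ 1) (hB : 0 ≤ B)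
    (hx : ∀ i ∈ s, |x i| ≤ 1)
    (hl : ∀ i ∈ s, |l i - lh i| ≤ 2 * ε) (ha : ∀ i ∈ s, |l i| * |a i - x i| ≤ 20 * ε)
    (had : ∀ i ∈ s, |a i - x i| ≤ d) (hb : ∀ i ∈ s, |l i| * |b i - u i| ≤ 20 * ε)
    (hb1 : ∀ i ∈ s, |b i| ≤ 1) (hu : ∑ i ∈ s, u i ^ 2 ≤ 1)
    (hA : 2 ^ p * (∑ i ∈ s, x i ^ 2 + s.card * d ^ (p - 1)) ≤ B ^ 2) :
    |∑ i ∈ s, (l i * x i ^ (p - 1) * u i - lh i * a i ^ (p - 1) * b i)| ≤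
      42 * p * 2 ^ p * (B + B ^ 2) * ε := by
  have hp1 : (1 : ℝ) ≤ p := by exact_mod_cast (by omega : 1 ≤ p)
  have h2p : (1 : ℝ) ≤ 2 ^ p := one_le_pow₀ one_le_two
  have hA' : ∑ i ∈ s, (|x i| + d) ^ (p - 1) ≤ B ^ 2 := by
    refine le_trans ?_ hA
    rw [← nsmul_eq_mul, ← Finset.sum_const, ← Finset.sum_add_distrib, Finset.mul_sum]
    refine Finset.sum_le_sum fun i hi => ?_
    refine (add_pow_le (abs_nonneg _) hd0 _).trans ?_
    have h1 : |x i| ^ (p - 1) ≤ x i ^ 2 := by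
      rw [← sq_abs]
      exact pow_le_pow_of_le_one (abs_nonneg _) (hx i hi) (by omega)
    have h2 : (2 : ℝ) ^ (p - 1 - 1) ≤ 2 ^ p := pow_le_pow_right₀ one_le_two (by omega)
    gcongr
  have hC : ∑ i ∈ s, (|x i| + d) ^ (p - 2) * |u i| ≤ 2 ^ p * B := by
    refine abs_le_of_sq_le_sq' ?_ (by positivity) |>.2
    refine (Finset.sum_mul_sq_le_sq_mul_sq s _ _).trans ?_
    simp only [sq_abs]
    have : ∑ i ∈ s, ((|x i| + d) ^ (p - 2)) ^ 2 ≤ 2 ^ p * B ^ 2 := by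
      refine le_trans ?_ (mul_le_mul_of_nonneg_left hA' (by positivity))
      rw [Finset.mul_sum]
      refine Finset.sum_le_sum fun i hi => ?_
      have hm : 0 ≤ |x i| + d := by positivity
      rw [← pow_mul, show (p - 2) * 2 = (p - 3) + (p - 1) by omega, pow_add]
      gcongr
      calc (|x i| + d) ^ (p - 3) ≤ 2 ^ (p - 3) := by
            gcongr
            linarith [hx i hi]
        _ ≤ 2 ^ p := pow_le_pow_right₀ one_le_two (by omega)
    calc _ ≤ 2 ^ p * B ^ 2 * 1 := by
          gcongr
      _ ≤ 2 ^ p * B ^ 2 * 2 ^ p := by gcongr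
      _ = (2 ^ p * B) ^ 2 := by ring
  calc _ ≤ ∑ i ∈ s, |l i * x i ^ (p - 1) * u i - lh i * a i ^ (p - 1) * b i| :=
        Finset.abs_sum_le_sum_abs _ _
    _ ≤ ∑ i ∈ s, ε * (22 * (|x i| + d) ^ (p - 1) + 20 * p * ((|x i| + d) ^ (p - 2) * |u i|)) :=
        Finset.sum_le_sum fun i hi => abs_deflation_term_le (hl i hi) (ha i hi)
          (had i hi) (hb i hi) (hb1 i hi)
    _ = ε * (22 * ∑ i ∈ s, (|x i| + d) ^ (p - 1) +
          20 * p * ∑ i ∈ s, (|x i| + d) ^ (p - 2) * |u i|) := by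
        rw [← Finset.mul_sum, Finset.sum_add_distrib, Finset.mul_sum, Finset.mul_sum]
    _ ≤ ε * (42 * p * 2 ^ p * (B + B ^ 2)) := by
        refine mul_le_mul_of_nonneg_left ?_ hε
        have e1 : (22 : ℝ) * B ^ 2 ≤ 42 * p * 2 ^ p * B ^ 2 := by
          have : (1 : ℝ) ≤ p * 2 ^ p := one_le_mul_of_one_le_of_one_le hp1 h2p
          nlinarith [mul_le_mul_of_nonneg_right this (sq_nonneg B)]
        have e2 : (20 : ℝ) * p * (2 ^ p * B) ≤ 42 * p * 2 ^ p * B := by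
          have : 0 ≤ (p : ℝ) * 2 ^ p * B := by positivity
          linarith
        calc _ ≤ 22 * B ^ 2 + 20 * p * (2 ^ p * B) := by gcongr
          _ ≤ 42 * p * 2 ^ p * B ^ 2 + 42 * p * 2 ^ p * B := add_le_add e1 e2
          _ = _ := by ring
    _ = _ := by ring

theorem Orthonormal.sum_sq_inner_le {ι F : Type*} [NormedAddCommGroup F] [InnerProductSpace ℝ F]
    {v : ι → F} (hv : Orthonormal ℝ v) {y : F} (hy : ‖y‖ = 1) (s : Finset ι) :
    ∑ l ∈ s, ⟪v l, y⟫ ^ 2 ≤ 1 := by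
  simpa [hy] using hv.sum_inner_products_le (x := y) (s := s)

theorem Orthonormal.sum_sq_inner_le_one_sub {ι F : Type*} [NormedAddCommGroup F]
    [InnerProductSpace ℝ F] {v : ι → F} (hv : Orthonormal ℝ v) {y : F} (hy : ‖y‖ = 1)
    {s : Finset ι} {j : ι} (hj : j ∉ s) :
    ∑ l ∈ s, ⟪v l, y⟫ ^ 2 ≤ 1 - ⟪v j, y⟫ ^ 2 := by
  have := hv.sum_sq_inner_le hy (s.cons j hj)
  rw [Finset.sum_cons] at this
  linarith

/-- A maximizer of a perturbed orthogonal form is aligned with one of its components. -/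
theorem exists_aligned_component {n p : ℕ} (hp : 4 ≤ p) (heven : Even p)
    {v : Fin n → EuclideanSpace ℝ (Fin n)} (hv : Orthonormal ℝ v) {lam : Fin n → ℝ}
    {S : Finset (Fin n)} (hS : Sᶜ.Nonempty) {μ ε γ K : ℝ}
    {g f : EuclideanSpace ℝ (Fin n) → ℝ} {x : EuclideanSpace ℝ (Fin n)}
    (hμ0 : 0 < μ) (hμ : ∀ l, μ ≤ |lam l|) (hε : 0 ≤ ε) (hK : 0 ≤ K)
    (hγ : (3 + K) * ε ≤ γ * μ) (hγ1 : γ ≤ 1 / 10)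
    (hf : ∀ y, f y = ∑ l ∈ Sᶜ, lam l * ⟪v l, y⟫ ^ p + g y)
    (hg : ∀ y, ‖y‖ = 1 → |g y| ≤ (1 + K) * ε)
    (hg1 : ∀ y, ‖y‖ = 1 → ∑ l ∈ S, ⟪v l, y⟫ ^ 2 ≤ γ → |g y| ≤ 2 * ε)
    (hx : ‖x‖ = 1) (hmax : ∀ y, ‖y‖ = 1 → |f y| ≤ |f x|) :
    ∃ M, ∃ j ∉ S, μ ≤ M ∧ (∀ l ∈ Sᶜ, |lam l| ≤ M) ∧
      M * (1 - γ) ≤ |lam j| * |⟪v j, x⟫| ^ (p - 2) ∧ 1 - γ ≤ ⟪v j, x⟫ ^ 2 ∧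
      f x ≠ 0 ∧ |lam j - f x| ≤ 2 * ε := by
  have hγ0 : 0 ≤ γ := by
    have : 0 ≤ γ * μ := le_trans (by positivity) hγ
    exact nonneg_of_mul_nonneg_left this hμ0
  obtain ⟨m, hm, hmM⟩ := Finset.exists_max_image Sᶜ (fun l => |lam l|) hS
  obtain ⟨j, hj, hjM⟩ :=
    Finset.exists_max_image Sᶜ (fun l => |lam l| * |⟪v l, x⟫| ^ (p - 2)) hS
  set M := |lam m| with hM
  have hμM : μ ≤ M := hμ m
  have hMγ : (3 + K) * ε ≤ M * γ := by nlinarith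
  have hMpos : 0 < M := hμ0.trans_le hμM
  have habs1 : ∀ l, |⟪v l, x⟫| ≤ 1 := fun l => by
    simpa [hv.1 l, hx] using abs_real_inner_le_norm (v l) x
  have hpow : ∀ l, ⟪v l, x⟫ ^ p = |⟪v l, x⟫| ^ (p - 2) * ⟪v l, x⟫ ^ 2 := fun l => by
    rw [← heven.pow_abs, ← sq_abs, ← pow_add]
    congr 1
    omega
  have hpow2 : ∀ l, |⟪v l, x⟫| ^ (p - 2) ≤ ⟪v l, x⟫ ^ 2 := fun l => by
    rw [← sq_abs]
    exact pow_le_pow_of_le_one (abs_nonneg _) (habs1 l) (by omega)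
  have hlow : M - 2 * ε ≤ |f x| := by
    refine le_trans ?_ (hmax (v m) (hv.1 m))
    have h1 : ∑ l ∈ Sᶜ, lam l * ⟪v l, v m⟫ ^ p = lam m := by
      rw [Finset.sum_eq_single m]
      · simp [hv.1 m]
      · intro l _ hl
        rw [hv.2 hl, zero_pow (by omega), mul_zero]
      · exact fun h => absurd hm h
    have h2 : ∑ l ∈ S, ⟪v l, v m⟫ ^ 2 = 0 := by
      refine Finset.sum_eq_zero fun l hl => ?_
      rw [hv.2 (fun h : l = m => (Finset.mem_compl.1 hm) (h ▸ hl))]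
      norm_num
    have h3 := hg1 (v m) (hv.1 m) (h2.le.trans hγ0)
    rw [hf, h1]
    have := abs_sub_abs_le_abs_sub (lam m) (-g (v m))
    rw [abs_neg, sub_neg_eq_add] at this
    linarith
  have hsum : ∑ l ∈ Sᶜ, |lam l| * ⟪v l, x⟫ ^ p ≤ |lam j| * |⟪v j, x⟫| ^ (p - 2) := by
    calc _ ≤ ∑ l ∈ Sᶜ, (|lam j| * |⟪v j, x⟫| ^ (p - 2)) * ⟪v l, x⟫ ^ 2 := by
          refine Finset.sum_le_sum fun l hl => ?_
          rw [hpow, ← mul_assoc]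
          exact mul_le_mul_of_nonneg_right (hjM l hl) (sq_nonneg _)
      _ ≤ _ := by
          rw [← Finset.mul_sum]
          exact mul_le_of_le_one_right (by positivity) (hv.sum_sq_inner_le hx _)
  have habssum : |∑ l ∈ Sᶜ, lam l * ⟪v l, x⟫ ^ p| ≤ ∑ l ∈ Sᶜ, |lam l| * ⟪v l, x⟫ ^ p := by
    refine (Finset.abs_sum_le_sum_abs _ _).trans_eq (Finset.sum_congr rfl fun l _ => ?_)
    rw [abs_mul, abs_of_nonneg (heven.pow_nonneg ⟪v l, x⟫)]
  have hup : |f x| ≤ |lam j| * |⟪v j, x⟫| ^ (p - 2) + |g x| := by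
    rw [hf]
    exact (abs_add_le _ _).trans (by linarith)
  have hdom : M * (1 - γ) ≤ |lam j| * |⟪v j, x⟫| ^ (p - 2) := by
    have := hg x hx
    linarith
  have hxj : 1 - γ ≤ |⟪v j, x⟫| ^ (p - 2) := by
    have h1 : |lam j| * |⟪v j, x⟫| ^ (p - 2) ≤ M * |⟪v j, x⟫| ^ (p - 2) :=
      mul_le_mul_of_nonneg_right (hmM j hj) (by positivity)
    exact le_of_mul_le_mul_left (hdom.trans h1) hMpos
  have hxj2 : 1 - γ ≤ ⟪v j, x⟫ ^ 2 := hxj.trans (hpow2 j)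
  have hjS : j ∉ S := Finset.mem_compl.1 hj
  have hgx : |g x| ≤ 2 * ε :=
    hg1 x hx ((hv.sum_sq_inner_le_one_sub hx hjS).trans (by linarith))
  have hlamj : |lam j| * |⟪v j, x⟫| ^ (p - 2) ≤ |lam j| :=
    mul_le_of_le_one_right (abs_nonneg _) (pow_le_one₀ (abs_nonneg _) (habs1 j))
  have hKε : 0 ≤ K * ε := by positivity
  have hrest : |f x - lam j * ⟪v j, x⟫ ^ p| ≤ 2 * (M * γ) := by
    have h1 : f x - lam j * ⟪v j, x⟫ ^ p =
        ∑ l ∈ Sᶜ.erase j, lam l * ⟪v l, x⟫ ^ p + g x := by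
      rw [hf, ← Finset.add_sum_erase _ _ hj]
      ring
    have h2 : |∑ l ∈ Sᶜ.erase j, lam l * ⟪v l, x⟫ ^ p| ≤ M * γ := by
      calc _ ≤ ∑ l ∈ Sᶜ.erase j, M * ⟪v l, x⟫ ^ 2 := by
            refine (Finset.abs_sum_le_sum_abs _ _).trans (Finset.sum_le_sum fun l hl => ?_)
            rw [abs_mul, abs_of_nonneg (heven.pow_nonneg ⟪v l, x⟫), hpow]
            refine mul_le_mul (hmM l (Finset.mem_of_mem_erase hl)) ?_ (by positivity) hMpos.le
            exact mul_le_of_le_one_left (sq_nonneg _) (pow_le_one₀ (abs_nonneg _) (habs1 l))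
        _ ≤ M * γ := by
            rw [← Finset.mul_sum]
            have := hv.sum_sq_inner_le_one_sub hx (Finset.notMem_erase j Sᶜ)
            exact mul_le_mul_of_nonneg_left (by linarith) hMpos.le
    rw [h1]
    exact (abs_add_le _ _).trans (by linarith)
  have hmain : 3 * (M * γ) < |lam j| * ⟪v j, x⟫ ^ p := by
    rw [hpow, ← mul_assoc]
    have h1 : M * (1 - γ) * (1 - γ) ≤ |lam j| * |⟪v j, x⟫| ^ (p - 2) * ⟪v j, x⟫ ^ 2 :=
      mul_le_mul hdom hxj2 (by linarith) (by positivity)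
    have h2 : 3 * γ < (1 - γ) * (1 - γ) := by nlinarith
    nlinarith
  have hMγ0 : 0 ≤ M * γ := by positivity
  refine ⟨M, j, hjS, hμM, hmM, hdom, hxj2, ?_, ?_⟩
  · intro h0
    rw [h0, zero_sub, abs_neg, abs_mul, abs_of_nonneg (heven.pow_nonneg ⟪v j, x⟫)] at hrest
    linarith
  · have hjm := hmM j hj
    rw [abs_le] at hrest
    rcases abs_cases (lam j) with ⟨h1, -⟩ | ⟨h1, -⟩
    · rw [h1] at hmain hup hlamj hjm
      have hpos : 0 < f x := by linarith
      rw [abs_of_pos hpos] at hlow hup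
      rw [abs_le]
      constructor <;> linarith
    · rw [h1] at hmain hup hlamj hjm
      have hneg : f x < 0 := by linarith
      rw [abs_of_neg hneg] at hlow hup
      rw [abs_le]
      constructor <;> linarith

/-- First-order optimality upgrades alignment to a linear bound on the direction. -/
theorem min_norm_sub_le_of_aligned {n p : ℕ} (hp : 4 ≤ p)
    {v : Fin n → EuclideanSpace ℝ (Fin n)} (hv : Orthonormal ℝ v) {lam : Fin n → ℝ}
    {S : Finset (Fin n)} {M ε γ : ℝ}
    {g f : EuclideanSpace ℝ (Fin n) → ℝ} {x : EuclideanSpace ℝ (Fin n)} {j : Fin n}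
    (hlam : lam j ≠ 0) (hjS : j ∉ S) (hε : 0 ≤ ε) (hγ1 : γ ≤ 1 / 10)
    (hM : ∀ l ∈ Sᶜ, |lam l| ≤ M)
    (hdom : M * (1 - γ) ≤ |lam j| * |⟪v j, x⟫| ^ (p - 2)) (hxj2 : 1 - γ ≤ ⟪v j, x⟫ ^ 2)
    (hf : ∀ y, f y = ∑ l ∈ Sᶜ, lam l * ⟪v l, y⟫ ^ p + g y)
    (hg : ∀ u, ‖u‖ = 1 → ⟪x, u⟫ = 0 →
      ∃ D, HasDerivAt (fun t : ℝ => g (Real.cos t • x + Real.sin t • u)) D 0 ∧ |D| ≤ 8 * p * ε)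
    (hx : ‖x‖ = 1) (hfx : f x ≠ 0) (hmax : ∀ y, ‖y‖ = 1 → |f y| ≤ |f x|) :
    min ‖v j - x‖ ‖v j + x‖ ≤ 20 * ε / |lam j| := by
  have hp0 : (0 : ℝ) < p := by exact_mod_cast (by omega : 0 < p)
  have hlam0 : 0 < |lam j| := abs_pos.2 hlam
  set c := ⟪v j, x⟫ with hc
  have hjmem : j ∈ Sᶜ := Finset.mem_compl.2 hjS
  have hMpos : 0 < M := hlam0.trans_le (hM j hjmem)
  have hc1 : |c| ≤ 1 := by simpa [hv.1 j, hx] using abs_real_inner_le_norm (v j) x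
  have hc2 : c ^ 2 ≤ |c| := by
    rw [← sq_abs]
    exact pow_le_of_le_one (abs_nonneg _) hc1 two_ne_zero
  obtain ⟨s, hs0, hs2⟩ : ∃ s : ℝ, 0 ≤ s ∧ s ^ 2 = 1 - c ^ 2 :=
    ⟨√(1 - c ^ 2), Real.sqrt_nonneg _, Real.sq_sqrt (by linarith)⟩
  have hdist : min ‖v j - x‖ ‖v j + x‖ ≤ 3 / 2 * s := by
    have h1 : ‖v j - x‖ ^ 2 = 2 - 2 * c := by
      rw [norm_sub_sq_real, hv.1 j, hx]; ring
    have h2 : ‖v j + x‖ ^ 2 = 2 + 2 * c := by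
      rw [norm_add_sq_real, hv.1 j, hx]; ring
    rcases abs_cases c with ⟨h, -⟩ | ⟨h, -⟩
    · refine (min_le_left _ _).trans (abs_le_of_sq_le_sq' ?_ (by positivity)).2
      nlinarith
    · refine (min_le_right _ _).trans (abs_le_of_sq_le_sq' ?_ (by positivity)).2
      nlinarith
  suffices h : |lam j| * s ≤ 12 * ε by
    refine hdist.trans ?_
    rw [le_div_iff₀ hlam0]
    linarith
  rcases hs0.eq_or_lt with rfl | hs
  · simpa using hε
  set u : EuclideanSpace ℝ (Fin n) := s⁻¹ • (v j - c • x) with hu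
  have hxv : ⟪x, v j⟫ = c := real_inner_comm _ _
  have hxu : ⟪x, u⟫ = 0 := by
    rw [hu, inner_smul_right, inner_sub_right, inner_smul_right, real_inner_self_eq_norm_sq, hx,
      hxv]
    ring
  have hu1 : ‖u‖ = 1 := by
    have : ‖v j - c • x‖ ^ 2 = s ^ 2 := by
      rw [norm_sub_sq_real, inner_smul_right, norm_smul, mul_pow, hv.1 j, hx, hs2,
        Real.norm_eq_abs, sq_abs]
      ring
    have h2 : ‖v j - c • x‖ = s := (pow_left_inj₀ (norm_nonneg _) hs0 two_ne_zero).1 this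
    rw [hu, norm_smul, h2, norm_inv, Real.norm_of_nonneg hs0, inv_mul_cancel₀ hs.ne']
  have huj : ⟪v j, u⟫ = s := by
    rw [hu, inner_smul_right, inner_sub_right, inner_smul_right, real_inner_self_eq_norm_sq,
      hv.1 j, ← hc]
    field_simp
    linarith
  have hul : ∀ l, l ≠ j → |⟪v l, u⟫| ≤ s⁻¹ * |⟪v l, x⟫| := fun l hl => by
    rw [hu, inner_smul_right, inner_sub_right, inner_smul_right, hv.2 hl, zero_sub, abs_mul,
      abs_neg, abs_mul, abs_of_pos (inv_pos.2 hs)]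
    gcongr
    exact mul_le_of_le_one_left (abs_nonneg _) hc1
  obtain ⟨D, hD, hDb⟩ := hg u hu1 hxu
  have hderiv : HasDerivAt (fun t : ℝ => f (Real.cos t • x + Real.sin t • u))
      (∑ l ∈ Sᶜ, lam l * (p * ⟪v l, x⟫ ^ (p - 1) * ⟪v l, u⟫) + D) 0 := by
    have := (HasDerivAt.fun_sum (u := Sᶜ) fun l _ =>
      (hasDerivAt_inner_circle_pow p (v l) x u).const_mul (lam l)).fun_add hD
    simpa only [hf] using this
  have hzero : ∑ l ∈ Sᶜ, lam l * (p * ⟪v l, x⟫ ^ (p - 1) * ⟪v l, u⟫) + D = 0 := by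
    have hloc : IsLocalMax (fun t : ℝ => f (Real.cos t • x + Real.sin t • u) ^ 2) 0 := by
      refine Filter.Eventually.of_forall fun t => ?_
      simp only [Real.cos_zero, Real.sin_zero, one_smul, zero_smul, add_zero]
      exact sq_le_sq.2 (hmax _ (norm_cos_smul_add_sin_smul hx hu1 hxu t))
    have := hloc.hasDerivAt_eq_zero (hderiv.fun_pow 2)
    simpa [hfx] using this
  have hrest : |∑ l ∈ Sᶜ.erase j, lam l * (⟪v l, x⟫ ^ (p - 1) * ⟪v l, u⟫)| ≤ M * (γ * s) := by
    have hb := hv.sum_sq_inner_le_one_sub hx (Finset.notMem_erase j Sᶜ)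
    rw [← hc, ← hs2] at hb
    calc _ ≤ ∑ l ∈ Sᶜ.erase j, M * s * ⟪v l, x⟫ ^ 2 := by
          refine (Finset.abs_sum_le_sum_abs _ _).trans (Finset.sum_le_sum fun l hl => ?_)
          have hlj := Finset.ne_of_mem_erase hl
          have hls : |⟪v l, x⟫| ≤ s := by
            refine abs_le_of_sq_le_sq ?_ hs0
            refine le_trans ?_ hb
            exact Finset.single_le_sum (f := fun l => ⟪v l, x⟫ ^ 2)
              (fun i _ => sq_nonneg _) hl
          have hs1 : s ≤ 1 := by nlinarith
          rw [abs_mul, abs_mul, abs_pow, mul_assoc M]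
          refine mul_le_mul (hM l (Finset.mem_of_mem_erase hl)) ?_ (by positivity) hMpos.le
          have h3 : |⟪v l, x⟫| ^ (p - 1) ≤ |⟪v l, x⟫| ^ 3 :=
            pow_le_pow_of_le_one (abs_nonneg _) (hls.trans hs1) (by omega)
          calc |⟪v l, x⟫| ^ (p - 1) * |⟪v l, u⟫|
              ≤ |⟪v l, x⟫| ^ 3 * (s⁻¹ * |⟪v l, x⟫|) := by
                gcongr
                exact hul l hlj
            _ = s⁻¹ * |⟪v l, x⟫| ^ 2 * |⟪v l, x⟫| ^ 2 := by ring
            _ ≤ s⁻¹ * s ^ 2 * |⟪v l, x⟫| ^ 2 := by gcongr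
            _ = s * ⟪v l, x⟫ ^ 2 := by
                rw [sq_abs]
                field_simp
      _ ≤ M * s * s ^ 2 := by
          rw [← Finset.mul_sum]
          gcongr
      _ ≤ M * s * γ := by
          gcongr
          linarith
      _ = _ := by ring
  have hsplit : (p : ℝ) * (lam j * (c ^ (p - 1) * s)) =
      -(p * ∑ l ∈ Sᶜ.erase j, lam l * (⟪v l, x⟫ ^ (p - 1) * ⟪v l, u⟫)) - D := by
    rw [← Finset.add_sum_erase _ _ hjmem, huj, ← hc] at hzero
    rw [Finset.mul_sum]
    have : ∀ l, (p : ℝ) * (lam l * (⟪v l, x⟫ ^ (p - 1) * ⟪v l, u⟫)) =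
      lam l * (p * ⟪v l, x⟫ ^ (p - 1) * ⟪v l, u⟫) := fun l => by ring
    simp only [this]
    linarith
  have hbound : |lam j| * |c| ^ (p - 2) * |c| * s ≤ M * (γ * s) + 8 * ε := by
    refine le_of_mul_le_mul_left ?_ hp0
    calc p * (|lam j| * |c| ^ (p - 2) * |c| * s)
        = |(p : ℝ) * (lam j * (c ^ (p - 1) * s))| := by
          rw [abs_mul, abs_mul, abs_mul, abs_pow, abs_of_pos hp0, abs_of_pos hs,
            show p - 1 = p - 2 + 1 by omega, pow_succ]
          ring
      _ ≤ p * (M * (γ * s)) + 8 * p * ε := by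
          rw [hsplit]
          refine (abs_sub _ _).trans (add_le_add ?_ hDb)
          rw [abs_neg, abs_mul, abs_of_pos hp0]
          gcongr
      _ = _ := by ring
  have hMs : M * (1 - γ) * (1 - γ) * s ≤ |lam j| * |c| ^ (p - 2) * |c| * s := by
    refine mul_le_mul_of_nonneg_right (mul_le_mul hdom ?_ ?_ ?_) hs0
    · linarith
    · linarith
    · positivity
  have hγ2 : (7 : ℝ) / 10 ≤ (1 - γ) * (1 - γ) - γ := by nlinarith
  have hjs : |lam j| * s ≤ M * s := mul_le_mul_of_nonneg_right (hM j hjmem) hs0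
  have : M * s * (7 / 10) ≤ M * s * ((1 - γ) * (1 - γ) - γ) :=
    mul_le_mul_of_nonneg_left hγ2 (by positivity)
  linarith

/-- One step of the greedy rank-one approximation: if the `k` pairs found so far approximate
distinct components, the next maximizer approximates a new component. -/
theorem exists_next_component {n p k : ℕ} (hp : 4 ≤ p) (heven : Even p) {L K c d μ ε : ℝ}
    (hL : L = 42 * p * 2 ^ p) (hK : K = L * (2 ^ p + (2 ^ p) ^ 2)) (hc0 : 0 < c)
    (hc : 2 ^ p * ((3 + K) * c + 20 * c) ≤ (1 / (2 * L)) ^ 2) (hcγ : (3 + K) * c ≤ 1 / 10)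
    (hc1 : 20 * c ≤ 1) (hd0 : 0 ≤ d) (hd1 : d ≤ 1) (hdn : n * d ^ (p - 1) ≤ 20 * c)
    (hμ0 : 0 < μ) (hε : 0 ≤ ε) (hεμ : ε ≤ c * μ) (hεd : 20 * ε ≤ d * μ)
    {lam : Fin n → ℝ} {v : Fin n → EuclideanSpace ℝ (Fin n)} (hv : Orthonormal ℝ v)
    (hμ : ∀ l, μ ≤ |lam l|) {E T : (Fin p → Fin n) → ℝ}
    (hE : ∀ y, ‖y‖ = 1 → |tapply E y| ≤ ε)
    {vh : ℕ → EuclideanSpace ℝ (Fin n)} {lamh : ℕ → ℝ} {π : ℕ → Fin n} (hk : k < n)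
    (hT : T = (∑ i, lam i • tpow p (v i)) + E - ∑ i ∈ Finset.range k, lamh i • tpow p (vh i))
    (hπ : Set.InjOn π (Finset.range k)) (hvh : ∀ i ∈ Finset.range k, ‖vh i‖ = 1)
    (hgood : ∀ i ∈ Finset.range k, |lam (π i) - lamh i| ≤ 2 * ε ∧
      min ‖v (π i) - vh i‖ ‖v (π i) + vh i‖ ≤ 20 * ε / |lam (π i)|)
    {x : EuclideanSpace ℝ (Fin n)} (hx : ‖x‖ = 1)
    (hmax : ∀ y, ‖y‖ = 1 → |tapply T y| ≤ |tapply T x|) :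
    ∃ j, (∀ i ∈ Finset.range k, π i ≠ j) ∧ |lam j - tapply T x| ≤ 2 * ε ∧
      min ‖v j - x‖ ‖v j + x‖ ≤ 20 * ε / |lam j| := by
  have hp1 : (1 : ℝ) ≤ p := by exact_mod_cast (by omega : 1 ≤ p)
  have h2p : (2 : ℝ) ≤ 2 ^ p := by
    simpa using pow_le_pow_right₀ (one_le_two : (1 : ℝ) ≤ 2) (by omega : 1 ≤ p)
  have hL1 : 1 ≤ L := by
    rw [hL]
    nlinarith [one_le_mul_of_one_le_of_one_le hp1 (one_le_two.trans h2p)]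
  have hK0 : 0 ≤ K := by rw [hK]; positivity
  have hpos : ∀ l, 0 < |lam l| := fun l => hμ0.trans_le (hμ l)
  have hsign : ∀ i, ∃ w : EuclideanSpace ℝ (Fin n), i ∈ Finset.range k →
      ‖w‖ = 1 ∧ (∀ y, ⟪w, y⟫ ^ p = ⟪vh i, y⟫ ^ p) ∧
        ‖w - v (π i)‖ ≤ 20 * ε / |lam (π i)| := by
    intro i
    by_cases hi : i ∈ Finset.range k
    · rcases min_le_iff.1 (hgood i hi).2 with h | h
      · exact ⟨vh i, fun _ => ⟨hvh i hi, fun _ => rfl, by rwa [norm_sub_rev]⟩⟩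
      · refine ⟨-vh i, fun _ => ⟨by rw [norm_neg, hvh i hi], fun y => ?_, ?_⟩⟩
        · rw [inner_neg_left, heven.neg_pow]
        · rwa [← norm_neg, neg_sub, sub_neg_eq_add]
    · exact ⟨0, fun h => absurd h hi⟩
  choose w hw using hsign
  set S := (Finset.range k).image π with hS
  have hsumS : ∀ y, ∑ l ∈ S, ⟪v l, y⟫ ^ 2 = ∑ i ∈ Finset.range k, ⟪v (π i), y⟫ ^ 2 := fun y =>
    Finset.sum_image hπ
  have hSc : Sᶜ.Nonempty := by
    rw [← Finset.card_pos, Finset.card_compl, Fintype.card_fin]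
    have : S.card ≤ k := Finset.card_image_le.trans_eq (Finset.card_range k)
    omega
  have hdefl : ∀ y u : EuclideanSpace ℝ (Fin n), ‖y‖ = 1 → ‖u‖ = 1 → ∀ B, 0 ≤ B →
      2 ^ p * (∑ l ∈ S, ⟪v l, y⟫ ^ 2 + 20 * c) ≤ B ^ 2 →
      |∑ i ∈ Finset.range k, (lam (π i) * ⟪v (π i), y⟫ ^ (p - 1) * ⟪v (π i), u⟫ -
        lamh i * ⟪w i, y⟫ ^ (p - 1) * ⟪w i, u⟫)| ≤ L * (B + B ^ 2) * ε := by
    intro y u hy hu B hB hA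
    have hdiff : ∀ i ∈ Finset.range k, ∀ z : EuclideanSpace ℝ (Fin n), ‖z‖ = 1 →
        |⟪w i, z⟫ - ⟪v (π i), z⟫| ≤ 20 * ε / |lam (π i)| := fun i hi z hz => by
      rw [← inner_sub_left]
      refine (abs_real_inner_le_norm _ _).trans ?_
      rw [hz, mul_one]
      exact (hw i hi).2.2
    have hdiff' : ∀ i ∈ Finset.range k, ∀ z : EuclideanSpace ℝ (Fin n), ‖z‖ = 1 →
        |lam (π i)| * |⟪w i, z⟫ - ⟪v (π i), z⟫| ≤ 20 * ε := fun i hi z hz => by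
      have := hdiff i hi z hz
      rwa [le_div_iff₀ (hpos _), mul_comm] at this
    rw [hL]
    refine abs_sum_deflation_le hp _ hε hd0 hd1 hB ?_ (fun i hi => (hgood i hi).1)
      (fun i hi => hdiff' i hi y hy) ?_ (fun i hi => hdiff' i hi u hu) ?_ ?_ ?_
    · intro i _
      simpa [hv.1, hy] using abs_real_inner_le_norm (v (π i)) y
    · intro i hi
      refine (hdiff i hi y hy).trans ?_
      rw [div_le_iff₀ (hpos _)]
      exact hεd.trans (mul_le_mul_of_nonneg_left (hμ _) hd0)
    · intro i hi
      simpa [(hw i hi).1, hu] using abs_real_inner_le_norm (w i) u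
    · rw [← hsumS]
      exact hv.sum_sq_inner_le hu S
    · refine le_trans ?_ hA
      rw [hsumS, Finset.card_range]
      have : (k : ℝ) * d ^ (p - 1) ≤ n * d ^ (p - 1) := by gcongr
      exact mul_le_mul_of_nonneg_left (by linarith) (by positivity)
  have hlocal : ∀ y u : EuclideanSpace ℝ (Fin n), ‖y‖ = 1 → ‖u‖ = 1 →
      ∑ l ∈ S, ⟪v l, y⟫ ^ 2 ≤ (3 + K) * c →
      |∑ i ∈ Finset.range k, (lam (π i) * ⟪v (π i), y⟫ ^ (p - 1) * ⟪v (π i), u⟫ -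
        lamh i * ⟪w i, y⟫ ^ (p - 1) * ⟪w i, u⟫)| ≤ ε := by
    intro y u hy hu hyS
    have hL0 : 0 < L := by linarith
    refine (hdefl y u hy hu (1 / (2 * L)) (by positivity) (le_trans ?_ hc)).trans ?_
    · gcongr
    · refine mul_le_of_le_one_left hε ?_
      have h1 : L * (1 / (2 * L) + (1 / (2 * L)) ^ 2) = 1 / 2 + 1 / (4 * L) := by
        field_simp
        ring
      have h2 : 1 / (4 * L) ≤ 1 / 4 := by
        rw [div_le_div_iff₀ (by positivity) (by norm_num)]
        linarith
      rw [h1]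
      linarith
  set g : EuclideanSpace ℝ (Fin n) → ℝ := fun y => tapply E y +
    ∑ i ∈ Finset.range k, (lam (π i) * ⟪v (π i), y⟫ ^ p - lamh i * ⟪w i, y⟫ ^ p) with hg
  have hf : ∀ y, tapply T y = ∑ l ∈ Sᶜ, lam l * ⟪v l, y⟫ ^ p + g y := by
    intro y
    have h1 : ∑ l ∈ S, lam l * ⟪v l, y⟫ ^ p =
        ∑ i ∈ Finset.range k, lam (π i) * ⟪v (π i), y⟫ ^ p := Finset.sum_image hπ
    have h2 : ∑ i ∈ Finset.range k, lamh i * ⟪w i, y⟫ ^ p =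
        ∑ i ∈ Finset.range k, lamh i * ⟪vh i, y⟫ ^ p :=
      Finset.sum_congr rfl fun i hi => by rw [(hw i hi).2.1]
    rw [hT, tapply_sub, tapply_add, tapply_sum, tapply_sum]
    simp only [tapply_smul, tapply_tpow, hg, Finset.sum_sub_distrib]
    rw [← Finset.sum_add_sum_compl S, h1, h2]
    ring
  have hpp : ∀ a : ℝ, a ^ (p - 1) * a = a ^ p := fun a => by
    rw [← pow_succ]
    congr 1
    omega
  have hg0 : ∀ y, ‖y‖ = 1 → |g y| ≤ (1 + K) * ε := fun y hy => by
    have h1 := hdefl y y hy hy (2 ^ p) (by positivity) (by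
      rw [sq]
      have := hv.sum_sq_inner_le hy S
      gcongr
      linarith)
    simp only [mul_assoc, hpp] at h1
    rw [one_add_mul]
    refine (abs_add_le _ _).trans (add_le_add (hE y hy) (h1.trans_eq ?_))
    rw [hK]
    ring
  have hg1 : ∀ y, ‖y‖ = 1 → ∑ l ∈ S, ⟪v l, y⟫ ^ 2 ≤ (3 + K) * c → |g y| ≤ 2 * ε :=
    fun y hy hyS => by
      have h1 := hlocal y y hy hy hyS
      simp only [mul_assoc, hpp] at h1
      rw [two_mul]
      exact (abs_add_le _ _).trans (add_le_add (hE y hy) h1)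
  obtain ⟨M, j, hjS, -, hM, hdom, hxj2, hfx, hval⟩ :=
    exists_aligned_component hp heven hv hSc hμ0 hμ hε hK0
      (show (3 + K) * ε ≤ ((3 + K) * c) * μ by
        rw [mul_assoc]
        gcongr) hcγ hf hg0 hg1 hx hmax
  refine ⟨j, fun i hi hij => hjS (hij ▸ Finset.mem_image_of_mem π hi), hval, ?_⟩
  refine min_norm_sub_le_of_aligned hp hv (abs_pos.1 (hpos j)) hjS hε hcγ hM hdom hxj2 hf
    ?_ hx hfx hmax
  intro u hu hxu
  obtain ⟨D, hD, hDb⟩ := exists_hasDerivAt_tapply_circle (by omega : 0 < p) (T := E)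
    (fun t => hE _ (norm_cos_smul_add_sin_smul hx hu hxu t))
  refine ⟨_, hD.fun_add (HasDerivAt.fun_sum (u := Finset.range k) fun i _ =>
    ((hasDerivAt_inner_circle_pow p (v (π i)) x u).const_mul (lam (π i))).fun_sub
      ((hasDerivAt_inner_circle_pow p (w i) x u).const_mul (lamh i))), ?_⟩
  have h1 := hlocal x u hx hu ((hv.sum_sq_inner_le_one_sub hx hjS).trans (by linarith))
  have h2 : ∑ i ∈ Finset.range k, (lam (π i) * (p * ⟪v (π i), x⟫ ^ (p - 1) * ⟪v (π i), u⟫) -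
      lamh i * (p * ⟪w i, x⟫ ^ (p - 1) * ⟪w i, u⟫)) =
      p * ∑ i ∈ Finset.range k, (lam (π i) * ⟪v (π i), x⟫ ^ (p - 1) * ⟪v (π i), u⟫ -
        lamh i * ⟪w i, x⟫ ^ (p - 1) * ⟪w i, u⟫) := by
    rw [Finset.mul_sum]
    exact Finset.sum_congr rfl fun i _ => by ring
  rw [h2]
  refine (abs_add_le _ _).trans ?_
  rw [abs_mul, Nat.abs_cast]
  have h3 := mul_le_mul_of_nonneg_left h1 (by positivity : (0 : ℝ) ≤ p)
  linarith

/-- Section 3.4 of the paper, even order. For every even `p ≥ 4` there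
is a constant `ĉ₀ = ĉ₀(p) > 0` such that: for every `n`, if `T̂ = ∑ λᵢ vᵢ^⊗p + E` with
`{vᵢ}` orthonormal, `λᵢ ≠ 0`, `E` symmetric of operator norm
`ε ≤ ĉ₀ (minᵢ |λᵢ|) / n^{1/(p−1)}`, and `{(λ̂ᵢ, v̂ᵢ)}` is the output of SROA on `T̂` where
each step maximizes `|T̂_{i−1} v^⊗p|` over unit vectors, then some permutation `π`
satisfies `|λ_{π(j)} − λ̂ⱼ| ≤ 2ε` and
`min{‖v_{π(j)} − v̂ⱼ‖₂, ‖v_{π(j)} + v̂ⱼ‖₂} ≤ 20 ε / |λ_{π(j)}|` for all `j`. -/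
theorem sroa_full_decomposition_even (p : ℕ) (heven : Even p) (hp : 4 ≤ p) :
    ∃ c₀ : ℝ, 0 < c₀ ∧
      ∀ (n : ℕ) (lam : Fin n → ℝ) (v : Fin n → EuclideanSpace ℝ (Fin n))
        (E : (Fin p → Fin n) → ℝ) (ε : ℝ)
        (Th : ℕ → (Fin p → Fin n) → ℝ)
        (vh : ℕ → EuclideanSpace ℝ (Fin n)) (lamh : ℕ → ℝ),
        (∀ i, lam i ≠ 0) →
        Orthonormal ℝ v →
        tsymm E →
        ε = tnorm E →
        ε ≤ c₀ * (⨅ i, |lam i|) / (n : ℝ) ^ ((1 : ℝ) / ((p : ℝ) - 1)) →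
        Th 0 = (∑ i, lam i • tpow p (v i)) + E →
        (∀ i < n, ‖vh i‖ = 1 ∧
          ∀ y : EuclideanSpace ℝ (Fin n), ‖y‖ = 1 →
            |tapply (Th i) y| ≤ |tapply (Th i) (vh i)|) →
        (∀ i < n, lamh i = tapply (Th i) (vh i)) →
        (∀ i < n, Th (i + 1) = Th i - lamh i • tpow p (vh i)) →
        ∃ π : Equiv.Perm (Fin n), ∀ j : Fin n,
          |lam (π j) - lamh j| ≤ 2 * ε ∧
            min ‖v (π j) - vh j‖ ‖v (π j) + vh j‖ ≤ 20 * ε / |lam (π j)| := by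
  obtain ⟨L, hL⟩ : ∃ L : ℝ, L = 42 * p * 2 ^ p := ⟨_, rfl⟩
  obtain ⟨K, hK⟩ : ∃ K : ℝ, K = L * (2 ^ p + (2 ^ p) ^ 2) := ⟨_, rfl⟩
  have hp4 : (4 : ℝ) ≤ p := by exact_mod_cast hp
  have h2p : (16 : ℝ) ≤ 2 ^ p := by
    calc (16 : ℝ) = 2 ^ 4 := by norm_num
      _ ≤ 2 ^ p := pow_le_pow_right₀ one_le_two hp
  have hL1 : 1 ≤ L := by rw [hL]; nlinarith
  have hK0 : 0 ≤ K := by rw [hK]; positivity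
  obtain ⟨c, hc⟩ : ∃ c : ℝ, c = 1 / (4 * 2 ^ p * L ^ 2 * (23 + K)) := ⟨_, rfl⟩
  have hc0 : 0 < c := by rw [hc]; positivity
  have hcK : (23 + K) * c = 1 / (4 * 2 ^ p * L ^ 2) := by
    rw [hc]; field_simp
  have hcK' : (23 + K) * c ≤ 1 / 10 := by
    rw [hcK]
    refine one_div_le_one_div_of_le (by norm_num) ?_
    have : 1 ≤ L ^ 2 := one_le_pow₀ hL1
    nlinarith
  have hKc : 0 ≤ K * c := by positivity
  have hc2 : 2 ^ p * ((3 + K) * c + 20 * c) ≤ (1 / (2 * L)) ^ 2 := by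
    have : (3 + K) * c + 20 * c = (23 + K) * c := by ring
    rw [this, hcK]
    apply le_of_eq
    field_simp
    norm_num
  refine ⟨c, hc0, ?_⟩
  intro n lam v E ε Th vh lamh hlam hv _ hε hle h0 hmax hlamh hstep
  rcases Nat.eq_zero_or_pos n with rfl | hn
  · exact ⟨Equiv.refl _, fun j => j.elim0⟩
  have : Nonempty (Fin n) := ⟨⟨0, hn⟩⟩
  have hE : ∀ y, ‖y‖ = 1 → |tapply E y| ≤ ε := fun y hy => hε ▸ abs_tapply_le_tnorm E hy
  have hε0 : 0 ≤ ε := (abs_nonneg _).trans (hE (v ⟨0, hn⟩) (hv.1 _))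
  obtain ⟨μ, hμdef⟩ : ∃ μ, μ = ⨅ i, |lam i| := ⟨_, rfl⟩
  rw [← hμdef] at hle
  have hμ : ∀ l, μ ≤ |lam l| := fun l => hμdef ▸ ciInf_le (Set.finite_range _).bddBelow l
  have hμ0 : 0 < μ := by
    obtain ⟨i, hi⟩ := exists_eq_ciInf_of_finite (f := fun i => |lam i|)
    rw [hμdef, ← hi]
    exact abs_pos.2 (hlam i)
  obtain ⟨N, hN⟩ : ∃ N : ℝ, N = (n : ℝ) ^ ((1 : ℝ) / ((p : ℝ) - 1)) := ⟨_, rfl⟩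
  rw [← hN] at hle
  have hn1 : (1 : ℝ) ≤ n := by exact_mod_cast hn
  have hN1 : 1 ≤ N := hN ▸ Real.one_le_rpow hn1 (by apply div_nonneg <;> linarith)
  have hN0 : 0 < N := by linarith
  have hNp : N ^ (p - 1) = n := by
    rw [hN, ← Real.rpow_natCast, ← Real.rpow_mul (by positivity),
      Nat.cast_sub (by omega : 1 ≤ p), Nat.cast_one, one_div_mul_cancel (by linarith),
      Real.rpow_one]
  have hεN : ε * N ≤ c * μ := (le_div_iff₀ hN0).1 hle
  have hεμ : ε ≤ c * μ := (le_mul_of_one_le_right hε0 hN1).trans hεN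
  have hd1 : 20 * c / N ≤ 1 := by
    rw [div_le_one hN0]
    linarith
  have hdn : n * (20 * c / N) ^ (p - 1) ≤ 20 * c := by
    rw [div_pow, hNp, mul_div_cancel₀ _ (by positivity)]
    exact pow_le_of_le_one (by positivity) (by linarith) (by omega)
  have hεd : 20 * ε ≤ 20 * c / N * μ := by
    rw [div_mul_eq_mul_div, le_div_iff₀ hN0]
    linarith
  have hTh : ∀ k ≤ n, Th k = (∑ i, lam i • tpow p (v i)) + E -
      ∑ i ∈ Finset.range k, lamh i • tpow p (vh i) := by
    intro k hk
    induction k with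
    | zero => simp [h0]
    | succ k ih =>
      rw [hstep k hk, ih (by omega), Finset.sum_range_succ]
      abel
  have hind : ∀ k ≤ n, ∃ π : ℕ → Fin n, Set.InjOn π (Finset.range k) ∧
      ∀ i ∈ Finset.range k, |lam (π i) - lamh i| ≤ 2 * ε ∧
        min ‖v (π i) - vh i‖ ‖v (π i) + vh i‖ ≤ 20 * ε / |lam (π i)| := by
    intro k hk
    induction k with
    | zero => exact ⟨fun _ => ⟨0, hn⟩, by simp, by simp⟩
    | succ k ih =>
      obtain ⟨π, hπ, hgood⟩ := ih (by omega)
      obtain ⟨j, hj, hj1, hj2⟩ := exists_next_component hp heven hL hK hc0 hc2 (by linarith)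
        (by linarith) (by positivity) hd1 hdn hμ0 hε0 hεμ hεd hv hμ hE hk (hTh k (by omega)) hπ
        (fun i hi => (hmax i (by have := Finset.mem_range.1 hi; omega)).1) hgood
        (hmax k hk).1 (hmax k hk).2
      rw [← hlamh k hk] at hj1
      have hne : ∀ i ∈ Finset.range k, i ≠ k := fun i hi => (Finset.mem_range.1 hi).ne
      refine ⟨Function.update π k j, ?_, ?_⟩
      · rw [Finset.range_add_one, Finset.coe_insert, Set.injOn_insert (by simp)]
        have heq : Set.EqOn (Function.update π k j) π (Finset.range k) := fun i hi =>
          Function.update_of_ne (hne i hi) _ _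
        refine ⟨hπ.congr heq.symm, ?_⟩
        rw [heq.image_eq, Function.update_self]
        rintro ⟨i, hi, hij⟩
        exact hj i hi hij
      · intro i hi
        rw [Finset.range_add_one, Finset.mem_insert] at hi
        rcases hi with rfl | hi
        · simpa only [Function.update_self] using ⟨hj1, hj2⟩
        · rw [Function.update_of_ne (hne i hi)]
          exact hgood i hi
  obtain ⟨π, hπ, hgood⟩ := hind n le_rfl
  have hinj : Function.Injective (fun i : Fin n => π i) := fun i j hij =>
    Fin.ext (hπ (by simp) (by simp) hij)
  exact ⟨Equiv.ofBijective _ (Finite.injective_iff_bijective.1 hinj), fun j =>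
    hgood j (Finset.mem_range.2 j.2)⟩
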